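/- Let θ₀, θ_R, θ₀', θ_R' ∈ S_{2π} and let H_{θ₀,θ_R} be the Schrödinger operator with (possibly complex) potential V ∈ L¹((0,R);dx). Then for every z ∈ ρ(H_{θ₀,θ_R}), the operator identity γ_{θ₀',θ_R'}(H_{θ₀,θ_R} − zI)^{-1}[γ_{θ̄₀',θ̄_R'}((H_{θ₀,θ_R})* − z̄I)^{-1}]* = (d/dz)[Λ_{θ₀,θ_R}^{θ₀',θ_R'}(z) S_{θ₀'−θ₀,θ_R'−θ_R}] holds as an equality of 2×2 matrices; here both sides are analytic in z on ρ(H_{θ₀,θ_R}). -/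

import Mathlib

open MeasureTheory Filter
open scoped InnerProductSpace

noncomputable section
open scoped Classical


variable {H : Type*} [NormedAddCommGroup H] [InnerProductSpace ℂ H] [CompleteSpace H]

/-- `T` is the (bounded, everywhere defined) inverse of `A - z·I`. -/
def IsResolvent (A : H →ₗ.[ℂ] H) (z : ℂ) (T : H →L[ℂ] H) : Prop :=
  (∀ x : H, ∃ hx : T x ∈ A.domain, A ⟨T x, hx⟩ - z • T x = x) ∧
  ∀ u : A.domain, T (A u - z • (u : H)) = (u : H)

/-- The resolvent set of an unbounded operator. -/
def resolventSetP (A : H →ₗ.[ℂ] H) : Set ℂ := {z | ∃ T, IsResolvent A z T}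

/-- The spectrum of an unbounded operator. -/
def specP (A : H →ₗ.[ℂ] H) : Set ℂ := (resolventSetP A)ᶜ

/-- The resolvent `(A - z·I)⁻¹` (junk value `0` off the resolvent set). -/
def res (A : H →ₗ.[ℂ] H) (z : ℂ) : H →L[ℂ] H :=
  if h : ∃ T, IsResolvent A z T then h.choose else 0

/-- The operator `A + t·I` (same domain). -/
def shiftP (A : H →ₗ.[ℂ] H) (t : ℂ) : H →ₗ.[ℂ] H :=
  ⟨A.domain, A.toFun + t • A.domain.subtype⟩

/-- `A` is of positive type: `(-∞,0] ⊆ ρ(A)` and `sup_{t ≥ 0} ‖(1+t)(A+t)⁻¹‖ < ∞`. -/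
def IsPositiveTypeP (A : H →ₗ.[ℂ] H) : Prop :=
  (∀ x : ℝ, x ≤ 0 → (x : ℂ) ∈ resolventSetP A) ∧
  ∃ M : ℝ, ∀ t : ℝ, 0 ≤ t → (1 + t) * ‖res A (-(t : ℂ))‖ ≤ M

/-- The open sector of half-opening angle `ω` about the positive reals
(`(0,∞)` for `ω = 0`). -/
def sectorS (ω : ℝ) : Set ℂ :=
  if ω = 0 then (fun x : ℝ => (x : ℂ)) '' Set.Ioi 0
  else {z : ℂ | z ≠ 0 ∧ |Complex.arg z| < ω}

/-- `A` is sectorial of angle `ω`. -/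
def IsSectorialP (A : H →ₗ.[ℂ] H) (ω : ℝ) : Prop :=
  specP A ⊆ closure (sectorS ω) ∧
  ∀ ω' : ℝ, ω < ω' → ω' < Real.pi →
    ∃ M : ℝ, ∀ z ∈ (closure (sectorS ω'))ᶜ, ‖z‖ * ‖res A z‖ ≤ M

/-- The shifted sector `-t₀ + S_ω`. -/
def shiftedSector (t0 ω : ℝ) : Set ℂ := (fun w => -(t0 : ℂ) + w) '' sectorS ω

/-- The region `ℂ \ closure (-t₀ + S_ω)`. -/
def offSector (t0 ω : ℝ) : Set ℂ := (closure (shiftedSector t0 ω))ᶜ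

/-- The bounded operator `(A - z·I)^{-1/2}`, defined by the Balakrishnan-type formula
`(1/π) ∫₀^∞ t^{-1/2} (A + (t - z)·I)⁻¹ dt`. -/
def negSqrt (A : H →ₗ.[ℂ] H) (z : ℂ) : H →L[ℂ] H :=
  ((Real.pi : ℂ))⁻¹ • ∫ t in Set.Ioi (0 : ℝ), ((Real.sqrt t : ℂ))⁻¹ • res A (z - t)

/-- Trace-class (nuclear) bounded operators, characterized by
`sup { ∑ |⟨eᵢ, T fᵢ⟩| : (eᵢ), (fᵢ) finite orthonormal families } < ∞`. -/
def IsTraceClass (T : H →L[ℂ] H) : Prop :=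
  ∃ C : ℝ, ∀ (n : ℕ) (e f : Fin n → H), Orthonormal ℂ e → Orthonormal ℂ f →
    ∑ i, ‖⟪e i, T (f i)⟫_ℂ‖ ≤ C

/-- The trace norm `‖T‖₁`. -/
def traceNorm (T : H →L[ℂ] H) : ℝ :=
  sSup {s : ℝ | ∃ (n : ℕ) (e f : Fin n → H), Orthonormal ℂ e ∧ Orthonormal ℂ f ∧
    s = ∑ i, ‖⟪e i, T (f i)⟫_ℂ‖}

/-- The trace of a (trace-class) operator, computed in the Hilbert basis `b`. -/
def traceH (b : HilbertBasis ℕ ℂ H) (T : H →L[ℂ] H) : ℂ :=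
  ∑' n, ⟪(b n : H), T (b n)⟫_ℂ

/-- The Fredholm determinant `det (I + T)` (for `T` trace class), computed as the limit of
finite-section determinants along the Hilbert basis `b`. -/
def detI (b : HilbertBasis ℕ ℂ H) (T : H →L[ℂ] H) : ℂ :=
  limUnder atTop fun F : Finset ℕ =>
    Matrix.det (Matrix.of fun i j : F =>
      (if (i : ℕ) = (j : ℕ) then (1 : ℂ) else 0) + ⟪(b (i : ℕ) : H), T (b (j : ℕ))⟫_ℂ)


/-! ### One-dimensional Schrödinger operators on `[0,R]` -/

/-- The underlying Hilbert space `L²((0,R); dx)`. -/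
abbrev SchSp (Rr : ℝ) :=
  MeasureTheory.Lp ℂ 2 (MeasureTheory.volume.restrict (Set.Ioo (0 : ℝ) Rr))

/-- `u` (with derivative `du`) solves `-u'' + V u = z u` on `[0,R]`, with
`u, u' ∈ AC([0,R])` (the second derivative being encoded in integrated form). -/
def SolODE (Rr : ℝ) (V : ℝ → ℂ) (z : ℂ) (u du : ℝ → ℂ) : Prop :=
  (∀ x ∈ Set.Icc (0 : ℝ) Rr, HasDerivWithinAt u (du x) (Set.Icc (0 : ℝ) Rr) x) ∧
  ∀ x ∈ Set.Icc (0 : ℝ) Rr, du x = du 0 + ∫ t in (0 : ℝ)..x, (V t - z) * u t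

/-- The boundary trace `γ_{θ₀,θ_R}(u) = (cos θ₀ u(0) + sin θ₀ u'(0),
cos θ_R u(R) - sin θ_R u'(R))`. -/
def bdryC (Rr : ℝ) (t0 tR : ℂ) (u du : ℝ → ℂ) : Fin 2 → ℂ :=
  ![Complex.cos t0 * u 0 + Complex.sin t0 * du 0,
    Complex.cos tR * u Rr - Complex.sin tR * du Rr]

/-- `g` (with derivative `dg`) is an absolutely continuous representative of `f ∈ L²`
satisfying `-g'' + V g - z g = h` (in integrated form, with `h₀` a representative of
`h ∈ L²`); i.e. `f` represents `(H - z)⁻¹ h`. -/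
def SolvesAt (Rr : ℝ) (V : ℝ → ℂ) (z : ℂ) (f h : SchSp Rr) (g dg : ℝ → ℂ) : Prop :=
  (∀ᵐ x ∂(MeasureTheory.volume.restrict (Set.Ioo (0 : ℝ) Rr)), f x = g x) ∧
  (∀ x ∈ Set.Icc (0 : ℝ) Rr, HasDerivWithinAt g (dg x) (Set.Icc (0 : ℝ) Rr) x) ∧
  ∃ h0 : ℝ → ℂ,
    (∀ᵐ x ∂(MeasureTheory.volume.restrict (Set.Ioo (0 : ℝ) Rr)), h x = h0 x) ∧
    ∀ x ∈ Set.Icc (0 : ℝ) Rr,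
      dg x = dg 0 + ∫ t in (0 : ℝ)..x, (V t * g t - z * g t - h0 t)

/-- `Hop` is the Schrödinger operator `H_{θ₀,θ_R} = -d²/dx² + V` in `L²((0,R); dx)` with
separated boundary conditions `γ_{θ₀,θ_R}(g) = 0`, characterized through its graph. -/
def IsSchrodingerOp (Rr : ℝ) (V : ℝ → ℂ) (t0 tR : ℂ)
    (Hop : SchSp Rr →ₗ.[ℂ] SchSp Rr) : Prop :=
  ∀ f h : SchSp Rr, (f, h) ∈ Hop.graph ↔
    ∃ g dg : ℝ → ℂ, SolvesAt Rr V 0 f h g dg ∧ bdryC Rr t0 tR g dg = 0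

/-- `Λ` is the boundary data map `Λ_{θ₀,θ_R}^{θ₀',θ_R'}(z)`: for every solution `u` of
`-u'' + Vu = zu`, `Λ` maps `γ_{θ₀,θ_R}(u)` to `γ_{θ₀',θ_R'}(u)`. -/
def IsBoundaryDataMap (Rr : ℝ) (V : ℝ → ℂ) (t0 tR t0' tR' : ℂ) (z : ℂ)
    (Λ : Matrix (Fin 2) (Fin 2) ℂ) : Prop :=
  ∀ u du : ℝ → ℂ, SolODE Rr V z u du →
    Λ.mulVec (bdryC Rr t0 tR u du) = bdryC Rr t0' tR' u du

/-- `G` is the map `γ_{θ₀',θ_R'} ∘ (Hop - z)⁻¹ : L²((0,R)) → ℂ²`. -/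
def IsBdryResolventMap (Rr : ℝ) (V : ℝ → ℂ) (t0' tR' : ℂ) (z : ℂ)
    (Hop : SchSp Rr →ₗ.[ℂ] SchSp Rr)
    (G : SchSp Rr →L[ℂ] EuclideanSpace ℂ (Fin 2)) : Prop :=
  ∀ (h : SchSp Rr) (g dg : ℝ → ℂ), SolvesAt Rr V z (res Hop z h) h g dg →
    ∀ i : Fin 2, G h i = bdryC Rr t0' tR' g dg i

/-- The region `ℂ \ [c, ∞)`. -/
def offCut (c : ℝ) : Set ℂ := {z : ℂ | z.im ≠ 0 ∨ z.re < c}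

/-- `N` is the family `z ↦ (Hop - z)^{-1/2}`, defined via the spectral theorem with branch
cut along `[c, ∞)` (`c = inf σ(Hop)`): analytic on `ℂ \ [c,∞)`, squaring to the resolvent,
and positive (self-adjoint) for real `z < c`. -/
def IsSqrtResFam (Rr : ℝ) (Hop : SchSp Rr →ₗ.[ℂ] SchSp Rr) (c : ℝ)
    (N : ℂ → (SchSp Rr →L[ℂ] SchSp Rr)) : Prop :=
  (∀ z ∈ offCut c, (N z).comp (N z) = res Hop z) ∧
  (∀ x : ℝ, x < c →
    (∀ v w : SchSp Rr, ⟪N (x : ℂ) v, w⟫_ℂ = ⟪v, N (x : ℂ) w⟫_ℂ) ∧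
    ∀ v : SchSp Rr, 0 ≤ (⟪v, N (x : ℂ) v⟫_ℂ).re) ∧
  DifferentiableOn ℂ N (offCut c)

/-- The infimum `e₀ = inf(σ(Hop) ∪ σ(Hop'))`. -/
def einf (Rr : ℝ) (Hop Hop' : SchSp Rr →ₗ.[ℂ] SchSp Rr) : ℝ :=
  sInf {x : ℝ | (x : ℂ) ∈ specP Hop ∪ specP Hop'}

/-- The infimum of the spectrum of a single operator. -/
def einf1 (Rr : ℝ) (Hop : SchSp Rr →ₗ.[ℂ] SchSp Rr) : ℝ :=
  sInf {x : ℝ | (x : ℂ) ∈ specP Hop}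


/-! ### Functions with an integrable second derivative -/

/-- `u` has derivative `du` on `[0,R]`, and `du` is a primitive of the integrable function `r`. -/
structure HasL1SecondDeriv (R : ℝ) (u du r : ℝ → ℂ) : Prop where
  integrable : IntegrableOn r (Set.Ioo 0 R)
  hasDeriv : ∀ x ∈ Set.Icc (0 : ℝ) R, HasDerivWithinAt u (du x) (Set.Icc (0 : ℝ) R) x
  eq_integral : ∀ x ∈ Set.Icc (0 : ℝ) R, du x = du 0 + ∫ t in (0 : ℝ)..x, r t

theorem intervalIntegrable_of_Ioo {R : ℝ} {r : ℝ → ℂ} (hr : IntegrableOn r (Set.Ioo 0 R))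
    {x : ℝ} (hx : x ∈ Set.Icc (0 : ℝ) R) : IntervalIntegrable r volume 0 x := by
  rw [intervalIntegrable_iff_integrableOn_Ioo_of_le hx.1]
  exact hr.mono_set (Set.Ioo_subset_Ioo_right hx.2)

theorem integral_congr_ae_Ioo {R : ℝ} {r r' : ℝ → ℂ}
    (h : r =ᵐ[volume.restrict (Set.Ioo 0 R)] r') {x : ℝ} (hx : x ∈ Set.Icc (0 : ℝ) R) :
    ∫ t in (0 : ℝ)..x, r t = ∫ t in (0 : ℝ)..x, r' t := by
  rw [intervalIntegral.integral_of_le hx.1, intervalIntegral.integral_of_le hx.1,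
    integral_Ioc_eq_integral_Ioo, integral_Ioc_eq_integral_Ioo]
  exact integral_congr_ae (ae_restrict_of_ae_restrict_of_subset
    (Set.Ioo_subset_Ioo_right hx.2) h)

namespace HasL1SecondDeriv

variable {R : ℝ} {u du r v dv s : ℝ → ℂ}

theorem congr_ae (h : HasL1SecondDeriv R u du r)
    (hrs : r =ᵐ[volume.restrict (Set.Ioo 0 R)] s) : HasL1SecondDeriv R u du s :=
  ⟨h.integrable.congr_fun_ae hrs, h.hasDeriv, fun x hx => by
    rw [h.eq_integral x hx, integral_congr_ae_Ioo hrs hx]⟩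

theorem add (hu : HasL1SecondDeriv R u du r) (hv : HasL1SecondDeriv R v dv s) :
    HasL1SecondDeriv R (u + v) (du + dv) (r + s) :=
  ⟨hu.integrable.add hv.integrable, fun x hx => (hu.hasDeriv x hx).add (hv.hasDeriv x hx),
    fun x hx => by
      simp only [Pi.add_apply]
      rw [intervalIntegral.integral_add (intervalIntegrable_of_Ioo hu.integrable hx)
        (intervalIntegrable_of_Ioo hv.integrable hx), hu.eq_integral x hx, hv.eq_integral x hx]
      ring⟩

theorem smul (c : ℂ) (hu : HasL1SecondDeriv R u du r) :
    HasL1SecondDeriv R (c • u) (c • du) (c • r) :=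
  ⟨hu.integrable.smul c, fun x hx => (hu.hasDeriv x hx).const_smul c,
    fun x hx => by
      simp only [Pi.smul_apply]
      rw [intervalIntegral.integral_smul, hu.eq_integral x hx, smul_add]⟩

theorem sub (hu : HasL1SecondDeriv R u du r) (hv : HasL1SecondDeriv R v dv s) :
    HasL1SecondDeriv R (u - v) (du - dv) (r - s) := by
  have := hu.add (hv.smul (-1))
  simpa [sub_eq_add_neg] using this

theorem conj (hu : HasL1SecondDeriv R u du r) :
    HasL1SecondDeriv R (star u) (star du) (star r) := by
  refine ⟨?_, fun x hx => (hu.hasDeriv x hx).star, fun x hx => ?_⟩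
  · exact Complex.conjCLE.toContinuousLinearMap.integrable_comp hu.integrable
  · simp only [Pi.star_apply]
    rw [hu.eq_integral x hx, star_add]
    congr 1
    exact ((Complex.conjCLE.toContinuousLinearMap).intervalIntegral_comp_comm
      (intervalIntegrable_of_Ioo hu.integrable hx)).symm

theorem continuousOn (hu : HasL1SecondDeriv R u du r) : ContinuousOn u (Set.Icc 0 R) :=
  fun x hx => (hu.hasDeriv x hx).continuousWithinAt

theorem continuousOn_deriv (hR : 0 ≤ R) (hu : HasL1SecondDeriv R u du r) :
    ContinuousOn du (Set.Icc 0 R) := by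
  have h : ContinuousOn (fun x => ∫ t in (0 : ℝ)..x, r t) (Set.uIcc 0 R) :=
    intervalIntegral.continuousOn_primitive_interval' (b₁ := 0) (b₂ := R)
      (intervalIntegrable_of_Ioo hu.integrable ⟨hR, le_rfl⟩) (by simp)
  rw [Set.uIcc_of_le hR] at h
  exact (continuousOn_const.add h).congr hu.eq_integral

/-- Fubini on the triangle `0 < t ≤ x ≤ R`. -/
theorem _root_.integral_mul_primitive {R : ℝ} (hR : 0 ≤ R) {f r : ℝ → ℂ}
    (hf : IntervalIntegrable f volume 0 R) (hr : IntervalIntegrable r volume 0 R) :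
    ∫ x in (0 : ℝ)..R, f x * ∫ t in (0 : ℝ)..x, r t =
      ∫ t in (0 : ℝ)..R, (∫ x in t..R, f x) * r t := by
  rw [intervalIntegrable_iff_integrableOn_Ioc_of_le hR] at hf hr
  have hint : Integrable (Function.uncurry fun x t : ℝ =>
      {p : ℝ × ℝ | p.2 ≤ p.1}.indicator (fun p => f p.1 * r p.2) (x, t))
      ((volume.restrict (Set.Ioc 0 R)).prod (volume.restrict (Set.Ioc 0 R))) := by
    exact (hf.mul_prod hr).indicator (measurableSet_le measurable_snd measurable_fst)
  have key := integral_integral_swap hint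
  rw [intervalIntegral.integral_of_le hR, intervalIntegral.integral_of_le hR]
  calc _ = ∫ x in Set.Ioc 0 R, ∫ t in Set.Ioc 0 R,
        {p : ℝ × ℝ | p.2 ≤ p.1}.indicator (fun p => f p.1 * r p.2) (x, t) := by
        refine setIntegral_congr_fun measurableSet_Ioc fun x hx => ?_
        rw [intervalIntegral.integral_of_le hx.1.le, ← integral_const_mul]
        have : (fun t => {p : ℝ × ℝ | p.2 ≤ p.1}.indicator (fun p => f p.1 * r p.2) (x, t)) =
            (Set.Iic x).indicator fun t => f x * r t := by
          ext t; simp [Set.indicator]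
        rw [this, setIntegral_indicator measurableSet_Iic]
        congr 2
        ext t; simp only [Set.mem_Ioc, Set.mem_inter_iff, Set.mem_Iic]
        constructor
        · rintro ⟨a, b⟩; exact ⟨⟨a, b.trans hx.2⟩, b⟩
        · rintro ⟨⟨a, b⟩, c⟩; exact ⟨a, c⟩
    _ = _ := key
    _ = _ := by
        refine setIntegral_congr_fun measurableSet_Ioc fun t ht => ?_
        rw [intervalIntegral.integral_of_le ht.2, ← integral_mul_const,
          ← integral_Icc_eq_integral_Ioc (x := t)]
        have : (fun x => {p : ℝ × ℝ | p.2 ≤ p.1}.indicator (fun p => f p.1 * r p.2) (x, t)) =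
            (Set.Ici t).indicator fun x => f x * r t := by
          ext x; simp [Set.indicator]
        rw [this, setIntegral_indicator measurableSet_Ici]
        congr 2
        ext x; simp only [Set.mem_Ioc, Set.mem_inter_iff, Set.mem_Icc, Set.mem_Ici]
        constructor
        · rintro ⟨⟨a, b⟩, c⟩; exact ⟨c, b⟩
        · rintro ⟨a, b⟩; exact ⟨⟨ht.1.trans_le a, b⟩, a⟩

theorem integral_deriv (hR : 0 ≤ R) (hu : HasL1SecondDeriv R u du r) {x : ℝ}
    (hx : x ∈ Set.Icc (0 : ℝ) R) : ∫ t in x..R, du t = u R - u x := by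
  refine intervalIntegral.integral_eq_sub_of_hasDerivAt_of_le hx.2
    (hu.continuousOn.mono (Set.Icc_subset_Icc_left hx.1)) (fun t ht => ?_) ?_
  · exact (hu.hasDeriv t ⟨hx.1.trans ht.1.le, ht.2.le⟩).hasDerivAt
      (Icc_mem_nhds (hx.1.trans_lt ht.1) ht.2)
  · refine ContinuousOn.intervalIntegrable ?_
    rw [Set.uIcc_of_le hx.2]
    exact (hu.continuousOn_deriv hR).mono (Set.Icc_subset_Icc_left hx.1)

theorem integrable_mul (hR : 0 ≤ R) (hu : HasL1SecondDeriv R u du r)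
    (hs : IntegrableOn s (Set.Ioo 0 R)) : IntervalIntegrable (fun t => u t * s t) volume 0 R := by
  refine (intervalIntegrable_of_Ioo hs ⟨hR, le_rfl⟩).continuousOn_mul ?_
  rw [Set.uIcc_of_le hR]
  exact hu.continuousOn

theorem integral_mul_eq (hR : 0 ≤ R) (hu : HasL1SecondDeriv R u du r)
    (hv : HasL1SecondDeriv R v dv s) :
    ∫ t in (0 : ℝ)..R, u t * s t =
      u R * dv R - u 0 * dv 0 - ∫ t in (0 : ℝ)..R, du t * dv t := by
  have hmem : R ∈ Set.Icc (0 : ℝ) R := ⟨hR, le_rfl⟩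
  have hcd : ContinuousOn du (Set.uIcc 0 R) := by
    rw [Set.uIcc_of_le hR]; exact hu.continuousOn_deriv hR
  have hcv : ContinuousOn dv (Set.uIcc 0 R) := by
    rw [Set.uIcc_of_le hR]; exact hv.continuousOn_deriv hR
  have hs := intervalIntegrable_of_Ioo hv.integrable hmem
  have h1 := integral_mul_primitive hR hcd.intervalIntegrable hs
  have h2 : ∫ x in (0 : ℝ)..R, du x * ∫ t in (0 : ℝ)..x, s t =
      (∫ x in (0 : ℝ)..R, du x * dv x) - (u R - u 0) * dv 0 := by
    have hdd : IntervalIntegrable (fun x => du x * dv x) volume 0 R :=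
      (hcd.mul hcv).intervalIntegrable
    rw [← hu.integral_deriv hR ⟨le_rfl, hR⟩, ← intervalIntegral.integral_mul_const,
      ← intervalIntegral.integral_sub hdd (hcd.intervalIntegrable.mul_const _)]
    refine intervalIntegral.integral_congr fun x hx => ?_
    rw [Set.uIcc_of_le hR] at hx
    rw [hv.eq_integral x hx]; ring
  have h3 : ∫ t in (0 : ℝ)..R, (∫ x in t..R, du x) * s t =
      u R * (dv R - dv 0) - ∫ t in (0 : ℝ)..R, u t * s t := by
    rw [show dv R - dv 0 = ∫ t in (0 : ℝ)..R, s t by rw [hv.eq_integral R hmem]; ring,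
      ← intervalIntegral.integral_const_mul,
      ← intervalIntegral.integral_sub (hs.const_mul _) (hu.integrable_mul hR hv.integrable)]
    refine intervalIntegral.integral_congr fun x hx => ?_
    rw [Set.uIcc_of_le hR] at hx
    rw [hu.integral_deriv hR hx]; ring
  rw [h2, h3] at h1
  linear_combination h1

/-- Green's formula. -/
theorem integral_wronskian (hR : 0 ≤ R) (hu : HasL1SecondDeriv R u du r)
    (hv : HasL1SecondDeriv R v dv s) :
    ∫ t in (0 : ℝ)..R, (u t * s t - v t * r t) =
      (u R * dv R - v R * du R) - (u 0 * dv 0 - v 0 * du 0) := by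
  rw [intervalIntegral.integral_sub (hu.integrable_mul hR hv.integrable)
    (hv.integrable_mul hR hu.integrable), hu.integral_mul_eq hR hv, hv.integral_mul_eq hR hu]
  simp only [mul_comm (dv _) (du _)]
  ring

theorem memLp (hu : HasL1SecondDeriv R u du r) :
    MemLp u 2 (volume.restrict (Set.Ioo 0 R)) := by
  obtain ⟨C, hC⟩ := isCompact_Icc.exists_bound_of_continuousOn hu.continuousOn
  refine MemLp.of_bound ?_ C ?_
  · exact (hu.continuousOn.mono Set.Ioo_subset_Icc_self).aestronglyMeasurable measurableSet_Ioo
  · exact (ae_restrict_iff' measurableSet_Ioo).2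
      (.of_forall fun x hx => hC x (Set.Ioo_subset_Icc_self hx))

end HasL1SecondDeriv

/-! ### Existence for the initial value problem -/

/-- The integral operator whose fixed points are the functions `x ↦ exp (-c x) u x` with
`u'' = q u`, `u 0 = a`, `u' 0 = b`. -/
def weightedVolterra (q : ℝ → ℂ) (c : ℝ) (a b : ℂ) (y : ℝ → ℂ) (x : ℝ) : ℂ :=
  Real.exp (-(c * x)) *
    (a + ∫ s in (0 : ℝ)..x, (b + ∫ t in (0 : ℝ)..s, q t * (Real.exp (c * t) * y t)))

section Volterra

variable {q : ℝ → ℂ} {c : ℝ} {y y' : ℝ → ℂ}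

theorem intervalIntegrable_weighted (hq : Integrable q) (hy : Continuous y) (s s' : ℝ) :
    IntervalIntegrable (fun t => q t * (Real.exp (c * t) * y t)) volume s s' :=
  hq.intervalIntegrable.mul_continuousOn (by fun_prop)

theorem continuous_weighted_primitive (hq : Integrable q) (hy : Continuous y) (b : ℂ) :
    Continuous fun s => b + ∫ t in (0 : ℝ)..s, q t * (Real.exp (c * t) * y t) :=
  continuous_const.add
    (intervalIntegral.continuous_primitive (intervalIntegrable_weighted hq hy) 0)

theorem continuous_weightedVolterra (hq : Integrable q) (hy : Continuous y) (a b : ℂ) :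
    Continuous (weightedVolterra q c a b y) := by
  have := intervalIntegral.continuous_primitive (μ := volume)
    (fun s s' => (continuous_weighted_primitive (c := c) hq hy b).intervalIntegrable s s') 0
  unfold weightedVolterra
  fun_prop

theorem norm_weightedVolterra_sub_le (hq : Integrable q) (hc : 0 < c) (hy : Continuous y)
    (hy' : Continuous y') {D : ℝ} (hD : ∀ t, ‖y t - y' t‖ ≤ D) (a b : ℂ) {x : ℝ} (hx : 0 ≤ x) :
    ‖weightedVolterra q c a b y x - weightedVolterra q c a b y' x‖ ≤
      (∫ t, ‖q t‖) / c * D := by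
  have hD0 : 0 ≤ D := (norm_nonneg _).trans (hD 0)
  have hK : 0 ≤ ∫ t, ‖q t‖ := integral_nonneg fun _ => norm_nonneg _
  have inner : ∀ s, 0 ≤ s → ‖(∫ t in (0 : ℝ)..s, q t * (Real.exp (c * t) * y t)) -
      ∫ t in (0 : ℝ)..s, q t * (Real.exp (c * t) * y' t)‖ ≤
        (∫ t, ‖q t‖) * D * Real.exp (c * s) := by
    intro s hs
    rw [← intervalIntegral.integral_sub (intervalIntegrable_weighted hq hy _ _)
      (intervalIntegrable_weighted hq hy' _ _)]
    calc _ ≤ ∫ t in (0 : ℝ)..s, ‖q t‖ * (Real.exp (c * s) * D) := by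
          refine intervalIntegral.norm_integral_le_of_norm_le hs (.of_forall fun t ht => ?_)
            (hq.norm.intervalIntegrable.mul_const _)
          rw [← mul_sub, ← mul_sub, norm_mul, norm_mul, Complex.norm_real,
            Real.norm_of_nonneg (Real.exp_nonneg _)]
          have := hD t
          have h2 : Real.exp (c * t) ≤ Real.exp (c * s) :=
            Real.exp_le_exp.2 (mul_le_mul_of_nonneg_left ht.2 hc.le)
          gcongr
      _ = (∫ t in Set.Ioc 0 s, ‖q t‖) * (Real.exp (c * s) * D) := by
          rw [intervalIntegral.integral_mul_const, intervalIntegral.integral_of_le hs]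
      _ ≤ (∫ t, ‖q t‖) * (Real.exp (c * s) * D) := by
          gcongr ?_ * _
          exact setIntegral_le_integral hq.norm (.of_forall fun _ => norm_nonneg _)
      _ = _ := by ring
  have hexp : ∫ s in (0 : ℝ)..x, (∫ t, ‖q t‖) * D * Real.exp (c * s) =
      (∫ t, ‖q t‖) * D * ((Real.exp (c * x) - 1) / c) := by
    rw [intervalIntegral.integral_const_mul, intervalIntegral.integral_comp_mul_left _ hc.ne',
      integral_exp]
    simp [div_eq_inv_mul]
  have outer : ‖∫ s in (0 : ℝ)..x, ((b + ∫ t in (0 : ℝ)..s, q t * (Real.exp (c * t) * y t)) -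
      (b + ∫ t in (0 : ℝ)..s, q t * (Real.exp (c * t) * y' t)))‖ ≤
        (∫ t, ‖q t‖) * D * ((Real.exp (c * x) - 1) / c) := by
    rw [← hexp]
    refine intervalIntegral.norm_integral_le_of_norm_le hx (.of_forall fun s hs => ?_)
      (Continuous.intervalIntegrable (by fun_prop) _ _)
    rw [add_sub_add_left_eq_sub]
    exact inner s hs.1.le
  rw [intervalIntegral.integral_sub
    ((continuous_weighted_primitive hq hy b).intervalIntegrable _ _)
    ((continuous_weighted_primitive hq hy' b).intervalIntegrable _ _)] at outer
  unfold weightedVolterra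
  rw [← mul_sub, add_sub_add_left_eq_sub, norm_mul, Complex.norm_real,
    Real.norm_of_nonneg (Real.exp_nonneg _)]
  calc _ ≤ Real.exp (-(c * x)) * ((∫ t, ‖q t‖) * D * (Real.exp (c * x) / c)) := by
        gcongr
        refine outer.trans ?_
        gcongr
        linarith
    _ = (Real.exp (-(c * x)) * Real.exp (c * x)) * ((∫ t, ‖q t‖) / c * D) := by ring
    _ = _ := by rw [← Real.exp_add]; simp

theorem exists_weightedVolterra_fixedPoint {R : ℝ} (hR : 0 ≤ R) (hq : Integrable q) (a b : ℂ) :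
    ∃ (c : ℝ) (y : ℝ → ℂ), Continuous y ∧
      ∀ x ∈ Set.Icc (0 : ℝ) R, y x = weightedVolterra q c a b y x := by
  have hK : 0 ≤ ∫ t, ‖q t‖ := integral_nonneg fun _ => norm_nonneg _
  obtain ⟨c, hcdef⟩ : ∃ c : ℝ, c = (∫ t, ‖q t‖) + 1 := ⟨_, rfl⟩
  have hc : 0 < c := by linarith
  let T : C(Set.Icc (0 : ℝ) R, ℂ) → C(Set.Icc (0 : ℝ) R, ℂ) := fun y =>
    ⟨fun x => weightedVolterra q c a b (Set.IccExtend hR y) x,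
      (continuous_weightedVolterra hq (y.continuous.Icc_extend' (h := hR)) a b).comp
        continuous_subtype_val⟩
  have hT : ContractingWith (((∫ t, ‖q t‖) / c).toNNReal) T := by
    refine ⟨?_, LipschitzWith.of_dist_le_mul fun y y' => ?_⟩
    · rw [Real.toNNReal_lt_one, div_lt_one hc]
      linarith
    · rw [Real.coe_toNNReal _ (by positivity)]
      refine (ContinuousMap.dist_le (by positivity)).2 fun x => ?_
      rw [dist_eq_norm]
      refine norm_weightedVolterra_sub_le hq hc y.continuous.Icc_extend'
        y'.continuous.Icc_extend' (fun t => ?_) a b x.2.1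
      rw [← dist_eq_norm]
      exact ContinuousMap.dist_apply_le_dist _
  refine ⟨c, Set.IccExtend hR ⇑(hT.fixedPoint), hT.fixedPoint.continuous.Icc_extend',
    fun x hx => ?_⟩
  have := congrArg (fun f : C(Set.Icc (0 : ℝ) R, ℂ) => f ⟨x, hx⟩) hT.fixedPoint_isFixedPt
  rw [Set.IccExtend_of_mem hR _ hx]
  exact this.symm

end Volterra

/-- Solvability of the initial value problem `u'' = q u` for integrable `q`. -/
theorem exists_hasL1SecondDeriv {R : ℝ} (hR : 0 ≤ R) {q : ℝ → ℂ}
    (hq : IntegrableOn q (Set.Ioo 0 R)) (a b : ℂ) :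
    ∃ u du : ℝ → ℂ, u 0 = a ∧ du 0 = b ∧ HasL1SecondDeriv R u du fun t => q t * u t := by
  have hq' : Integrable ((Set.Ioo 0 R).indicator q) := hq.integrable_indicator measurableSet_Ioo
  obtain ⟨c, y, hy, hfix⟩ := exists_weightedVolterra_fixedPoint hR hq' a b
  have hcont := continuous_weighted_primitive (c := c) hq' hy b
  have hu : ∀ x ∈ Set.Icc (0 : ℝ) R, Real.exp (c * x) * y x = a + ∫ s in (0 : ℝ)..x,
      (b + ∫ t in (0 : ℝ)..s, (Set.Ioo 0 R).indicator q t * (Real.exp (c * t) * y t)) := by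
    intro x hx
    rw [hfix x hx, weightedVolterra, ← mul_assoc, ← Complex.ofReal_mul, ← Real.exp_add]
    simp
  have h0 : (0 : ℝ) ∈ Set.Icc (0 : ℝ) R := ⟨le_rfl, hR⟩
  have main : HasL1SecondDeriv R (fun x => Real.exp (c * x) * y x)
      (fun s => b + ∫ t in (0 : ℝ)..s, (Set.Ioo 0 R).indicator q t * (Real.exp (c * t) * y t))
      (fun t => (Set.Ioo 0 R).indicator q t * (Real.exp (c * t) * y t)) := by
    refine ⟨?_, fun x hx => ?_, fun x hx => by simp⟩
    · rw [← intervalIntegrable_iff_integrableOn_Ioo_of_le hR]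
      exact intervalIntegrable_weighted hq' hy 0 R
    · refine HasDerivWithinAt.congr ?_ hu (hu x hx)
      exact ((intervalIntegral.integral_hasDerivAt_right (hcont.intervalIntegrable 0 x)
        hcont.stronglyMeasurable.stronglyMeasurableAtFilter
        hcont.continuousAt).const_add a).hasDerivWithinAt
  refine ⟨_, _, by simpa using hu 0 h0, by simp, main.congr_ae ?_⟩
  filter_upwards [ae_restrict_mem measurableSet_Ioo] with t ht
  rw [Set.indicator_of_mem ht]

/-! ### Resolvents of unbounded operators -/

namespace IsResolvent

variable {A : H →ₗ.[ℂ] H} {z : ℂ} {T T' : H →L[ℂ] H}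

theorem apply_eq_iff (hT : IsResolvent A z T) {f h : H} :
    T h = f ↔ (f, h + z • f) ∈ A.graph := by
  rw [LinearPMap.mem_graph_iff]
  constructor
  · rintro rfl
    obtain ⟨hx, hA⟩ := hT.1 h
    exact ⟨⟨T h, hx⟩, rfl, sub_eq_iff_eq_add.1 hA⟩
  · rintro ⟨u, rfl, hu⟩
    have := hT.2 u
    rwa [hu, add_sub_cancel_right] at this

theorem unique (hT : IsResolvent A z T) (hT' : IsResolvent A z T') : T = T' := by
  ext h
  exact hT.apply_eq_iff.2 (hT'.apply_eq_iff.1 rfl)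

theorem res_eq (hT : IsResolvent A z T) : res A z = T := by
  have h : ∃ T, IsResolvent A z T := ⟨T, hT⟩
  rw [res, dif_pos h]
  exact h.choose_spec.unique hT

theorem adjoint (hT : IsResolvent A z T) (hA : Dense (A.domain : Set H)) :
    IsResolvent A.adjoint (starRingEnd ℂ z) (ContinuousLinearMap.adjoint T) := by
  constructor
  · intro x
    have key : ∀ u : A.domain,
        ⟪x + (starRingEnd ℂ z) • ContinuousLinearMap.adjoint T x, (u : H)⟫_ℂ =
          ⟪ContinuousLinearMap.adjoint T x, A u⟫_ℂ := by
      intro u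
      have h1 : ⟪ContinuousLinearMap.adjoint T x, A u - z • (u : H)⟫_ℂ = ⟪x, (u : H)⟫_ℂ := by
        rw [ContinuousLinearMap.adjoint_inner_left, hT.2 u]
      rw [inner_sub_right, inner_smul_right] at h1
      rw [inner_add_left, inner_smul_left, Complex.conj_conj]
      linear_combination -h1
    have hx := LinearPMap.mem_adjoint_domain_of_exists _ ⟨_, key⟩
    refine ⟨hx, ?_⟩
    rw [LinearPMap.adjoint_apply_eq hA ⟨_, hx⟩ key, add_sub_cancel_right]
  · intro u
    refine ext_inner_right ℂ fun x => ?_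
    obtain ⟨hx, hAx⟩ := hT.1 x
    have h1 := LinearPMap.adjoint_isFormalAdjoint hA u ⟨T x, hx⟩
    rw [ContinuousLinearMap.adjoint_inner_left, inner_sub_left, h1, inner_smul_left,
      Complex.conj_conj, ← inner_smul_right, ← inner_sub_right, hAx]

end IsResolvent

theorem isResolvent_res {A : H →ₗ.[ℂ] H} {z : ℂ} (hz : z ∈ resolventSetP A) :
    IsResolvent A z (res A z) := by
  obtain ⟨T, hT⟩ := hz
  rwa [hT.res_eq]

theorem isOpen_resolventSetP (A : H →ₗ.[ℂ] H) : IsOpen (resolventSetP A) := by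
  rw [isOpen_iff_mem_nhds]
  rintro z ⟨T, hT⟩
  have hcont : Continuous fun w : ℂ => (1 : H →L[ℂ] H) - (w - z) • T := by fun_prop
  have hmem : {w : ℂ | IsUnit ((1 : H →L[ℂ] H) - (w - z) • T)} ∈ nhds z :=
    (Units.isOpen.preimage hcont).mem_nhds (by simp)
  filter_upwards [hmem] with w hw
  obtain ⟨B, hB⟩ := hw
  have hBapply : ∀ x, (B : H →L[ℂ] H) x = x - (w - z) • T x := fun x => by simp [hB]
  refine ⟨T * (↑B⁻¹ : H →L[ℂ] H), fun x => ?_, fun u => ?_⟩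
  · obtain ⟨hx, hA⟩ := hT.1 ((↑B⁻¹ : H →L[ℂ] H) x)
    refine ⟨hx, ?_⟩
    have h1 : (B : H →L[ℂ] H) ((↑B⁻¹ : H →L[ℂ] H) x) = x := by
      rw [← mul_apply_eq_comp, Units.mul_inv, one_apply_eq_self]
    rw [hBapply] at h1
    refine Eq.trans ?_ h1
    rw [sub_eq_iff_eq_add] at hA
    simp only [mul_apply_eq_comp]
    rw [hA]
    module
  · have h1 : A u - w • (u : H) = (B : H →L[ℂ] H) (A u - z • (u : H)) := by
      rw [hBapply, hT.2 u]; module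
    rw [h1, mul_apply_eq_comp, ← mul_apply_eq_comp (↑B⁻¹ : H →L[ℂ] H),
      Units.inv_mul, one_apply_eq_self, hT.2 u]

/-! ### Boundary value problems -/

theorem bdryC_add (R : ℝ) (a b : ℂ) (u du v dv : ℝ → ℂ) :
    bdryC R a b (u + v) (du + dv) = bdryC R a b u du + bdryC R a b v dv := by
  ext i; fin_cases i <;> simp [bdryC] <;> ring

theorem bdryC_smul (R : ℝ) (a b c : ℂ) (u du : ℝ → ℂ) :
    bdryC R a b (c • u) (c • du) = c • bdryC R a b u du := by
  ext i; fin_cases i <;> simp [bdryC] <;> ring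

theorem bdryC_sub (R : ℝ) (a b : ℂ) (u du v dv : ℝ → ℂ) :
    bdryC R a b (u - v) (du - dv) = bdryC R a b u du - bdryC R a b v dv := by
  ext i; fin_cases i <;> simp [bdryC] <;> ring

theorem bdryC_conj (R : ℝ) (a b : ℂ) (u du : ℝ → ℂ) :
    bdryC R (starRingEnd ℂ a) (starRingEnd ℂ b) (star u) (star du) = star (bdryC R a b u du) := by
  ext i; fin_cases i <;> simp [bdryC, Complex.cos_conj, Complex.sin_conj]

/-- Green's formula in terms of the boundary traces, when one function has vanishing trace: the
Wronskian boundary terms pair the trace of `u` with the complementary trace of `v`. -/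
theorem wronskian_eq_of_bdryC_eq_zero {R : ℝ} {a b : ℂ} {u du v dv : ℝ → ℂ}
    (hv : bdryC R a b v dv = 0) :
    (u R * dv R - v R * du R) - (u 0 * dv 0 - v 0 * du 0) =
      bdryC R a b u du 1 * (Complex.sin b * v R + Complex.cos b * dv R) -
        bdryC R a b u du 0 * (Complex.cos a * dv 0 - Complex.sin a * v 0) := by
  have h0 := congrFun hv 0
  have h1 := congrFun hv 1
  simp only [bdryC, Matrix.cons_val_zero, Matrix.cons_val_one, Pi.zero_apply] at h0 h1 ⊢
  have sa := Complex.sin_sq_add_cos_sq a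
  have sb := Complex.sin_sq_add_cos_sq b
  linear_combination (Complex.sin b * u R + Complex.cos b * du R) * (-h1)
    - (u R * dv R - v R * du R) * sb + (u 0 * dv 0 - v 0 * du 0) * sa
    + (Complex.cos a * du 0 - Complex.sin a * u 0) * h0

theorem bdryC_apply_zero_of_eq_zero {R : ℝ} {a b a' b' : ℂ} {v dv : ℝ → ℂ}
    (hv : bdryC R a b v dv = 0) :
    bdryC R a' b' v dv 0 =
      Complex.sin (a' - a) * (Complex.cos a * dv 0 - Complex.sin a * v 0) := by
  have h0 := congrFun hv 0
  simp only [bdryC, Matrix.cons_val_zero, Pi.zero_apply] at h0 ⊢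
  have sa := Complex.sin_sq_add_cos_sq a
  rw [Complex.sin_sub]
  linear_combination (Complex.cos a' * Complex.cos a + Complex.sin a' * Complex.sin a) * h0
    - (Complex.cos a' * v 0 + Complex.sin a' * dv 0) * sa

theorem bdryC_apply_one_of_eq_zero {R : ℝ} {a b a' b' : ℂ} {v dv : ℝ → ℂ}
    (hv : bdryC R a b v dv = 0) :
    bdryC R a' b' v dv 1 =
      -(Complex.sin (b' - b) * (Complex.sin b * v R + Complex.cos b * dv R)) := by
  have h1 := congrFun hv 1
  simp only [bdryC, Matrix.cons_val_zero, Matrix.cons_val_one, Pi.zero_apply] at h1 ⊢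
  have sb := Complex.sin_sq_add_cos_sq b
  rw [Complex.sin_sub]
  linear_combination (Complex.cos b' * Complex.cos b + Complex.sin b' * Complex.sin b) * h1
    - (Complex.cos b' * v R - Complex.sin b' * dv R) * sb

theorem inner_eq_integral {R : ℝ} (hR : 0 ≤ R) {f g : SchSp R} {p q : ℝ → ℂ}
    (hf : f =ᵐ[volume.restrict (Set.Ioo 0 R)] star p)
    (hg : g =ᵐ[volume.restrict (Set.Ioo 0 R)] q) :
    ⟪f, g⟫_ℂ = ∫ t in (0 : ℝ)..R, p t * q t := by
  rw [L2.inner_def, intervalIntegral.integral_of_le hR, integral_Ioc_eq_integral_Ioo]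
  refine integral_congr_ae ?_
  filter_upwards [hf, hg] with t h1 h2
  rw [h1, h2]
  simp [mul_comm]

theorem HasL1SecondDeriv.integral_pairing {R : ℝ} (hR : 0 ≤ R) {V : ℝ → ℂ} {z : ℂ}
    {u du v dv k l : ℝ → ℂ}
    (hu : HasL1SecondDeriv R u du fun t => (V t - z) * u t - k t)
    (hv : HasL1SecondDeriv R v dv fun t => (V t - z) * v t - l t) :
    ∫ t in (0 : ℝ)..R, (v t * k t - u t * l t) =
      (u R * dv R - v R * du R) - (u 0 * dv 0 - v 0 * du 0) := by
  rw [← hu.integral_wronskian hR hv]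
  congr 1
  ext t
  ring

theorem integrableOn_coeFn {R : ℝ} (h : SchSp R) : IntegrableOn h (Set.Ioo 0 R) :=
  (Lp.memLp h).integrable one_le_two

theorem integrableOn_mul_continuousOn {R : ℝ} (hR : 0 ≤ R) {q g : ℝ → ℂ}
    (hq : IntegrableOn q (Set.Ioo 0 R)) (hg : ContinuousOn g (Set.Icc 0 R)) :
    IntegrableOn (fun t => q t * g t) (Set.Ioo 0 R) := by
  rw [← intervalIntegrable_iff_integrableOn_Ioo_of_le hR]
  refine (intervalIntegrable_of_Ioo hq ⟨hR, le_rfl⟩).mul_continuousOn ?_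
  rwa [Set.uIcc_of_le hR]

theorem integrableOn_sub_const {R : ℝ} {V : ℝ → ℂ} (hV : IntegrableOn V (Set.Ioo 0 R)) (z : ℂ) :
    IntegrableOn (fun t => V t - z) (Set.Ioo 0 R) :=
  hV.sub (integrableOn_const (by simp))

theorem solvesAt_iff {R : ℝ} (hR : 0 ≤ R) {V : ℝ → ℂ} (hV : IntegrableOn V (Set.Ioo 0 R))
    {z : ℂ} {f h : SchSp R} {g dg : ℝ → ℂ} :
    SolvesAt R V z f h g dg ↔ f =ᵐ[volume.restrict (Set.Ioo 0 R)] g ∧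
      HasL1SecondDeriv R g dg fun t => (V t - z) * g t - h t := by
  constructor
  · rintro ⟨hf, hg, h0, hh, hdg⟩
    refine ⟨hf, ⟨?_, hg, fun x hx => ?_⟩⟩
    · exact (integrableOn_mul_continuousOn hR (integrableOn_sub_const hV z)
        fun x hx => (hg x hx).continuousWithinAt).sub (integrableOn_coeFn h)
    · rw [hdg x hx]
      congr 1
      refine integral_congr_ae_Ioo ?_ hx
      filter_upwards [hh] with t ht
      rw [ht]; ring
  · rintro ⟨hf, hg⟩
    refine ⟨hf, hg.hasDeriv, h, .of_forall fun _ => rfl, fun x hx => ?_⟩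
    rw [hg.eq_integral x hx]
    simp only [sub_mul]

namespace IsSchrodingerOp

variable {R : ℝ} {V : ℝ → ℂ} {a b : ℂ} {A : SchSp R →ₗ.[ℂ] SchSp R}

theorem mem_graph_iff (hA : IsSchrodingerOp R V a b A) (hR : 0 ≤ R)
    (hV : IntegrableOn V (Set.Ioo 0 R)) (z : ℂ) {f h : SchSp R} :
    (f, h + z • f) ∈ A.graph ↔
      ∃ g dg : ℝ → ℂ, SolvesAt R V z f h g dg ∧ bdryC R a b g dg = 0 := by
  rw [hA]
  refine exists_congr fun g => exists_congr fun dg => and_congr_left fun _ => ?_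
  rw [solvesAt_iff hR hV, solvesAt_iff hR hV]
  refine and_congr_right fun hf => ?_
  have hae : (fun t => (V t - 0) * g t - (h + z • f : SchSp R) t)
      =ᵐ[volume.restrict (Set.Ioo 0 R)] fun t => (V t - z) * g t - h t := by
    filter_upwards [hf, Lp.coeFn_add h (z • f), Lp.coeFn_smul z f] with t h1 h2 h3
    rw [h2, Pi.add_apply, h3, Pi.smul_apply, h1, smul_eq_mul]; ring
  exact ⟨fun h => h.congr_ae hae, fun h => h.congr_ae hae.symm⟩

theorem res_eq_iff (hA : IsSchrodingerOp R V a b A) (hR : 0 ≤ R)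
    (hV : IntegrableOn V (Set.Ioo 0 R)) {z : ℂ} (hz : z ∈ resolventSetP A) {f h : SchSp R} :
    res A z h = f ↔ ∃ g dg : ℝ → ℂ, SolvesAt R V z f h g dg ∧ bdryC R a b g dg = 0 := by
  rw [(isResolvent_res hz).apply_eq_iff, hA.mem_graph_iff hR hV]

/-- Off the spectrum, the solutions of the homogeneous equation realize every boundary datum. -/
theorem exists_bdryC_eq (hA : IsSchrodingerOp R V a b A) (hR : 0 < R)
    (hV : IntegrableOn V (Set.Ioo 0 R)) {z : ℂ} (hz : z ∈ resolventSetP A) (e : Fin 2 → ℂ) :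
    ∃ u du : ℝ → ℂ, HasL1SecondDeriv R u du (fun t => (V t - z) * u t) ∧
      bdryC R a b u du = e := by
  obtain ⟨φ, dφ, hφ0, hdφ0, hφ⟩ :=
    exists_hasL1SecondDeriv hR.le (integrableOn_sub_const hV z) 1 0
  obtain ⟨ψ, dψ, hψ0, hdψ0, hψ⟩ :=
    exists_hasL1SecondDeriv hR.le (integrableOn_sub_const hV z) 0 1
  have hcomb : ∀ c : Fin 2 → ℂ, HasL1SecondDeriv R (c 0 • φ + c 1 • ψ) (c 0 • dφ + c 1 • dψ)
      (fun t => (V t - z) * (c 0 • φ + c 1 • ψ) t) := by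
    intro c
    refine ((hφ.smul (c 0)).add (hψ.smul (c 1))).congr_ae (.of_forall fun t => ?_)
    simp only [Pi.add_apply, Pi.smul_apply, smul_eq_mul]; ring
  let L : (Fin 2 → ℂ) →ₗ[ℂ] (Fin 2 → ℂ) :=
    { toFun := fun c => bdryC R a b (c 0 • φ + c 1 • ψ) (c 0 • dφ + c 1 • dψ)
      map_add' := fun c d => by
        simp only [bdryC_add, bdryC_smul, Pi.add_apply, add_smul]; abel
      map_smul' := fun m c => by
        simp only [bdryC_add, bdryC_smul, Pi.smul_apply, smul_eq_mul, mul_smul, smul_add,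
          RingHom.id_apply] }
  have hinj : Function.Injective L := by
    rw [← LinearMap.ker_eq_bot, LinearMap.ker_eq_bot']
    intro c hc
    have hu := hcomb c
    have hres : res A z 0 = hu.memLp.toLp := by
      refine (hA.res_eq_iff hR.le hV hz).2 ⟨_, _, (solvesAt_iff hR.le hV).2
        ⟨hu.memLp.coeFn_toLp, hu.congr_ae ?_⟩, hc⟩
      filter_upwards [Lp.coeFn_zero ℂ 2 (volume.restrict (Set.Ioo 0 R))] with t ht
      rw [ht]; simp
    rw [map_zero] at hres
    have hae : (c 0 • φ + c 1 • ψ) =ᵐ[volume.restrict (Set.Icc 0 R)] fun _ => (0 : ℂ) := by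
      rw [Measure.restrict_congr_set Ioo_ae_eq_Icc.symm]
      refine hu.memLp.coeFn_toLp.symm.trans ?_
      rw [← hres]
      exact Lp.coeFn_zero ℂ 2 _
    have heq : Set.EqOn (c 0 • φ + c 1 • ψ) (fun _ => (0 : ℂ)) (Set.Icc 0 R) :=
      Measure.eqOn_Icc_of_ae_eq volume hR.ne hae hu.continuousOn continuousOn_const
    have h0 : (0 : ℝ) ∈ Set.Icc 0 R := ⟨le_rfl, hR.le⟩
    have hval := heq h0
    have hder : (c 0 • dφ + c 1 • dψ) 0 = 0 :=
      (uniqueDiffOn_Icc hR 0 h0).eq_deriv _ (hu.hasDeriv 0 h0)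
        ((hasDerivWithinAt_const (0 : ℝ) (Set.Icc 0 R) (0 : ℂ)).congr heq hval)
    ext i
    fin_cases i
    · simpa [hφ0, hψ0] using hval
    · simpa [hdφ0, hdψ0] using hder
  obtain ⟨c, hc⟩ := (LinearMap.injective_iff_surjective.1 hinj) e
  exact ⟨_, _, hcomb c, hc⟩

/-- The adjoint of the resolvent is its complex conjugate. -/
theorem adjoint_res_apply (hA : IsSchrodingerOp R V a b A) (hR : 0 ≤ R)
    (hV : IntegrableOn V (Set.Ioo 0 R)) {z : ℂ} (hz : z ∈ resolventSetP A) (h : SchSp R) :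
    ContinuousLinearMap.adjoint (res A z) h = star (res A z (star h)) := by
  refine ext_inner_right ℂ fun x => ?_
  rw [ContinuousLinearMap.adjoint_inner_left]
  obtain ⟨p, dp, hp, hpb⟩ := (hA.res_eq_iff hR hV hz (h := star h)).1 rfl
  obtain ⟨g, dg, hg, hgb⟩ := (hA.res_eq_iff hR hV hz (h := x)).1 rfl
  rw [solvesAt_iff hR hV] at hp hg
  have hstar : (h : ℝ → ℂ) =ᵐ[volume.restrict (Set.Ioo 0 R)]
      star ((star h : SchSp R) : ℝ → ℂ) := by
    filter_upwards [Lp.coeFn_star h] with t ht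
    simp [ht]
  have hpstar : (star (res A z (star h)) : SchSp R) =ᵐ[volume.restrict (Set.Ioo 0 R)] star p := by
    filter_upwards [Lp.coeFn_star (res A z (star h)), hp.1] with t h1 h2
    simp [h1, h2]
  rw [inner_eq_integral hR hstar hg.1, inner_eq_integral hR hpstar (ae_eq_refl x)]
  have key := hp.2.integral_pairing hR hg.2
  rw [wronskian_eq_of_bdryC_eq_zero hgb, hpb] at key
  have hint := hg.2.integrable_mul hR (integrableOn_coeFn (star h))
  have hint' := hp.2.integrable_mul hR (integrableOn_coeFn x)
  rw [intervalIntegral.integral_sub hint hint'] at key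
  simp only [Pi.zero_apply, zero_mul, sub_zero] at key
  simp only [mul_comm _ (g _)]
  linear_combination key

theorem res_adjoint (hA : IsSchrodingerOp R V a b A) (hR : 0 ≤ R)
    (hV : IntegrableOn V (Set.Ioo 0 R)) (hdense : Dense (A.domain : Set (SchSp R)))
    {z : ℂ} (hz : z ∈ resolventSetP A) (h : SchSp R) :
    res A.adjoint (starRingEnd ℂ z) h = star (res A z (star h)) := by
  rw [((isResolvent_res hz).adjoint hdense).res_eq, hA.adjoint_res_apply hR hV hz]

end IsSchrodingerOp

/-! ### The boundary data map -/

namespace IsSchrodingerOp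

variable {R : ℝ} {V : ℝ → ℂ} {a b a' b' : ℂ} {A : SchSp R →ₗ.[ℂ] SchSp R}

theorem solvesAt_sub (hR : 0 ≤ R) (hV : IntegrableOn V (Set.Ioo 0 R)) {z w : ℂ}
    {u du v dv : ℝ → ℂ} {U W : SchSp R}
    (hu : HasL1SecondDeriv R u du fun t => (V t - z) * u t)
    (hv : HasL1SecondDeriv R v dv fun t => (V t - w) * v t)
    (hU : U =ᵐ[volume.restrict (Set.Ioo 0 R)] u) (hW : W =ᵐ[volume.restrict (Set.Ioo 0 R)] v) :
    SolvesAt R V z (W - U) ((w - z) • W) (v - u) (dv - du) := by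
  refine (solvesAt_iff hR hV).2 ⟨?_, (hv.sub hu).congr_ae ?_⟩
  · filter_upwards [Lp.coeFn_sub W U, hU, hW] with t h1 h2 h3
    rw [h1, Pi.sub_apply, Pi.sub_apply, h2, h3]
  · filter_upwards [Lp.coeFn_smul (w - z) W, hW] with t h1 h2
    rw [h1, Pi.smul_apply, h2]
    simp only [Pi.sub_apply, smul_eq_mul]; ring

/-- Difference of two solutions, at different spectral parameters, with the same boundary data. -/
theorem res_smul_eq_sub (hA : IsSchrodingerOp R V a b A) (hR : 0 ≤ R)
    (hV : IntegrableOn V (Set.Ioo 0 R)) {z w : ℂ} (hz : z ∈ resolventSetP A)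
    {u du v dv : ℝ → ℂ} {U W : SchSp R}
    (hu : HasL1SecondDeriv R u du fun t => (V t - z) * u t)
    (hv : HasL1SecondDeriv R v dv fun t => (V t - w) * v t)
    (hU : U =ᵐ[volume.restrict (Set.Ioo 0 R)] u) (hW : W =ᵐ[volume.restrict (Set.Ioo 0 R)] v)
    (huv : bdryC R a b u du = bdryC R a b v dv) :
    res A z ((w - z) • W) = W - U :=
  (hA.res_eq_iff hR hV hz).2
    ⟨_, _, solvesAt_sub hR hV hu hv hU hW, by rw [bdryC_sub, huv, sub_self]⟩

theorem bdryC_sub_eq (hA : IsSchrodingerOp R V a b A) (hR : 0 ≤ R)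
    (hV : IntegrableOn V (Set.Ioo 0 R)) {z w : ℂ} (hz : z ∈ resolventSetP A)
    {u du v dv : ℝ → ℂ} {U W : SchSp R}
    (hu : HasL1SecondDeriv R u du fun t => (V t - z) * u t)
    (hv : HasL1SecondDeriv R v dv fun t => (V t - w) * v t)
    (hU : U =ᵐ[volume.restrict (Set.Ioo 0 R)] u) (hW : W =ᵐ[volume.restrict (Set.Ioo 0 R)] v)
    (huv : bdryC R a b u du = bdryC R a b v dv)
    {G : SchSp R →L[ℂ] EuclideanSpace ℂ (Fin 2)} (hG : IsBdryResolventMap R V a' b' z A G)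
    (i : Fin 2) :
    bdryC R a' b' v dv i - bdryC R a' b' u du i = (w - z) * G W i := by
  have h := solvesAt_sub hR hV hu hv hU hW
  rw [← hA.res_smul_eq_sub hR hV hz hu hv hU hW huv] at h
  have := hG _ _ _ h i
  rw [bdryC_sub, map_smul] at this
  simpa using this.symm

/-- `γ' ((H - z)⁻¹ h̄)` is given by pairing with the solutions of the homogeneous equation. -/
theorem bdryC_res_star (hR : 0 ≤ R) (hV : IntegrableOn V (Set.Ioo 0 R)) {z : ℂ}
    {h f U : SchSp R} {p dp u du : ℝ → ℂ} {j : Fin 2}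
    (hp : SolvesAt R V z f (star h) p dp) (hpb : bdryC R a b p dp = 0)
    (hu : HasL1SecondDeriv R u du fun t => (V t - z) * u t)
    (hub : bdryC R a b u du = Pi.single j 1)
    (hU : U =ᵐ[volume.restrict (Set.Ioo 0 R)] u) :
    bdryC R a' b' p dp j =
      (![Complex.sin (a' - a), Complex.sin (b' - b)] : Fin 2 → ℂ) j * ⟪h, U⟫_ℂ := by
  rw [solvesAt_iff hR hV] at hp
  have hstar : (h : ℝ → ℂ) =ᵐ[volume.restrict (Set.Ioo 0 R)]
      star ((star h : SchSp R) : ℝ → ℂ) := by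
    filter_upwards [Lp.coeFn_star h] with t ht
    simp [ht]
  have hu' : HasL1SecondDeriv R u du fun t => (V t - z) * u t - (fun _ => (0 : ℂ)) t := by
    simpa using hu
  have key := hu'.integral_pairing hR hp.2
  rw [wronskian_eq_of_bdryC_eq_zero hpb, hub] at key
  have hneg : ∫ t in (0 : ℝ)..R, (p t * 0 - u t * (star h : SchSp R) t) = -⟪h, U⟫_ℂ := by
    rw [inner_eq_integral hR hstar hU, ← intervalIntegral.integral_neg]
    refine intervalIntegral.integral_congr fun t _ => ?_
    ring
  rw [hneg] at key
  fin_cases j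
  · simp only [Fin.zero_eta, Pi.single_eq_same, ne_eq, one_ne_zero, not_false_eq_true,
      Pi.single_eq_of_ne, zero_mul, zero_sub, one_mul, neg_inj, Matrix.cons_val_zero] at key ⊢
    rw [bdryC_apply_zero_of_eq_zero hpb, key]
  · simp only [Fin.mk_one, Pi.single_eq_same, ne_eq, zero_ne_one, not_false_eq_true,
      Pi.single_eq_of_ne, zero_mul, sub_zero, one_mul, Matrix.cons_val_one,
      Matrix.cons_val_zero] at key ⊢
    rw [bdryC_apply_one_of_eq_zero hpb, ← key, mul_neg, neg_neg]

theorem adjoint_bdryResolventMap_single (hA : IsSchrodingerOp R V a b A) (hR : 0 ≤ R)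
    (hV : IntegrableOn V (Set.Ioo 0 R)) (hdense : Dense (A.domain : Set (SchSp R)))
    {z : ℂ} (hz : z ∈ resolventSetP A) {G : SchSp R →L[ℂ] EuclideanSpace ℂ (Fin 2)}
    (hG : IsBdryResolventMap R (fun x => starRingEnd ℂ (V x)) (starRingEnd ℂ a')
      (starRingEnd ℂ b') (starRingEnd ℂ z) A.adjoint G)
    {u du : ℝ → ℂ} {U : SchSp R} {j : Fin 2}
    (hu : HasL1SecondDeriv R u du fun t => (V t - z) * u t)
    (hub : bdryC R a b u du = Pi.single j 1)
    (hU : U =ᵐ[volume.restrict (Set.Ioo 0 R)] u) :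
    ContinuousLinearMap.adjoint G (EuclideanSpace.single j 1) =
      (![Complex.sin (a' - a), Complex.sin (b' - b)] : Fin 2 → ℂ) j • U := by
  refine ext_inner_right ℂ fun h => ?_
  obtain ⟨p, dp, hp, hpb⟩ := (hA.res_eq_iff hR hV hz (h := star h)).1 rfl
  have hp' := (solvesAt_iff hR hV).1 hp
  have hVc : IntegrableOn (fun x => starRingEnd ℂ (V x)) (Set.Ioo 0 R) :=
    Complex.conjCLE.toContinuousLinearMap.integrable_comp hV
  have hsolve : SolvesAt R (fun x => starRingEnd ℂ (V x)) (starRingEnd ℂ z)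
      (res A.adjoint (starRingEnd ℂ z) h) h (star p) (star dp) := by
    rw [hA.res_adjoint hR hV hdense hz]
    refine (solvesAt_iff hR hVc).2 ⟨?_, hp'.2.conj.congr_ae ?_⟩
    · filter_upwards [Lp.coeFn_star (res A z (star h)), hp'.1] with t h1 h2
      rw [h1, Pi.star_apply, h2, Pi.star_apply]
    · filter_upwards [Lp.coeFn_star h] with t ht
      simp [ht]
  have hGh := hG _ _ _ hsolve j
  rw [bdryC_conj, Pi.star_apply, bdryC_res_star hR hV hp hpb hu hub hU] at hGh
  rw [ContinuousLinearMap.adjoint_inner_left, EuclideanSpace.inner_single_left, hGh,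
    inner_smul_left, ← inner_conj_symm U h]
  simp

theorem exists_solution_family (hA : IsSchrodingerOp R V a b A) (hR : 0 < R)
    (hV : IntegrableOn V (Set.Ioo 0 R)) (e : Fin 2 → ℂ) :
    ∃ (u du : ℂ → ℝ → ℂ) (U : ℂ → SchSp R), ∀ z ∈ resolventSetP A,
      HasL1SecondDeriv R (u z) (du z) (fun t => (V t - z) * u z t) ∧
        bdryC R a b (u z) (du z) = e ∧ U z =ᵐ[volume.restrict (Set.Ioo 0 R)] u z := by
  have h : ∀ z ∈ resolventSetP A, ∃ (u du : ℝ → ℂ) (U : SchSp R),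
      HasL1SecondDeriv R u du (fun t => (V t - z) * u t) ∧
        bdryC R a b u du = e ∧ U =ᵐ[volume.restrict (Set.Ioo 0 R)] u := fun z hz => by
    obtain ⟨u, du, hu, hub⟩ := hA.exists_bdryC_eq hR hV hz e
    exact ⟨u, du, hu.memLp.toLp, hu, hub, hu.memLp.coeFn_toLp⟩
  choose! u du U hU using h
  exact ⟨u, du, U, hU⟩

end IsSchrodingerOp

theorem continuousWithinAt_of_res_smul_eq_sub {A : H →ₗ.[ℂ] H} {U : ℂ → H} {z : ℂ} {s : Set ℂ}
    (hU : ∀ w ∈ s, res A z ((w - z) • U w) = U w - U z) :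
    ContinuousWithinAt U s z := by
  set M := ‖res A z‖
  have hbound : ∀ w ∈ s, ‖w - z‖ * M ≤ 1 / 2 → ‖U w - U z‖ ≤ ‖w - z‖ * (M * (2 * ‖U z‖)) := by
    intro w hw hsmall
    have h1 : ‖U w - U z‖ ≤ ‖w - z‖ * M * ‖U w‖ := by
      rw [← hU w hw, map_smul, norm_smul, mul_assoc]
      gcongr
      exact (res A z).le_opNorm _
    have h2 : ‖U w‖ ≤ ‖U w - U z‖ + ‖U z‖ := by
      simpa using norm_add_le (U w - U z) (U z)
    have h3 : ‖w - z‖ * M * ‖U w‖ ≤ 1 / 2 * ‖U w‖ := by gcongr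
    have h4 : ‖U w‖ ≤ 2 * ‖U z‖ := by linarith
    calc _ ≤ ‖w - z‖ * M * ‖U w‖ := h1
      _ ≤ ‖w - z‖ * M * (2 * ‖U z‖) := by gcongr
      _ = _ := by ring
  have htend : ∀ C : ℝ, Tendsto (fun w : ℂ => ‖w - z‖ * C) (nhdsWithin z s) (nhds 0) := by
    intro C
    have : Continuous fun w : ℂ => ‖w - z‖ * C := by fun_prop
    simpa using this.continuousWithinAt (s := s) (x := z) |>.tendsto
  rw [ContinuousWithinAt, tendsto_iff_norm_sub_tendsto_zero]
  refine squeeze_zero' (.of_forall fun _ => norm_nonneg _) ?_ (htend (M * (2 * ‖U z‖)))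
  filter_upwards [self_mem_nhdsWithin,
    (htend M).eventually_le_const (show (0 : ℝ) < 1 / 2 by norm_num)] with w hw hsmall
  exact hbound w hw hsmall

theorem hasDerivWithinAt_of_sub_eq {f g : ℂ → ℂ} {s : Set ℂ} {z : ℂ}
    (hg : ContinuousWithinAt g s z) (hf : ∀ w ∈ s, f w - f z = (w - z) * g w) :
    HasDerivWithinAt f (g z) s z := by
  rw [hasDerivWithinAt_iff_tendsto_slope]
  refine (hg.mono Set.sdiff_subset).tendsto.congr' ?_
  filter_upwards [self_mem_nhdsWithin] with w hw
  rw [slope_def_field, hf w hw.1, mul_div_cancel_left₀ _ (sub_ne_zero.2 hw.2)]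

/-- Lemma 4.1: the operator identity
`γ_{θ₀',θ_R'}(H - z)⁻¹ [γ_{θ̄₀',θ̄_R'}(H* - z̄)⁻¹]* = (d/dz)[Λ_{θ₀,θ_R}^{θ₀',θ_R'}(z)
S_{θ₀'-θ₀,θ_R'-θ_R}]` on `ρ(H_{θ₀,θ_R})`, both sides being analytic there. -/
theorem statement16
    (Rr : ℝ) (hR : 0 < Rr) (V : ℝ → ℂ)
    (hV : MeasureTheory.IntegrableOn V (Set.Ioo 0 Rr) MeasureTheory.volume)
    (t0 tR t0' tR' : ℂ)
    (ht0 : 0 ≤ t0.re ∧ t0.re < 2 * Real.pi) (htR : 0 ≤ tR.re ∧ tR.re < 2 * Real.pi)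
    (ht0' : 0 ≤ t0'.re ∧ t0'.re < 2 * Real.pi) (htR' : 0 ≤ tR'.re ∧ tR'.re < 2 * Real.pi)
    (Hop : SchSp Rr →ₗ.[ℂ] SchSp Rr) (hHop : IsSchrodingerOp Rr V t0 tR Hop)
    (hdense : Dense (Hop.domain : Set (SchSp Rr)))
    (Λ : ℂ → Matrix (Fin 2) (Fin 2) ℂ)
    (hΛ : ∀ z ∈ resolventSetP Hop, IsBoundaryDataMap Rr V t0 tR t0' tR' z (Λ z))
    (Gp : ℂ → (SchSp Rr →L[ℂ] EuclideanSpace ℂ (Fin 2)))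
    (hGp : ∀ z ∈ resolventSetP Hop, IsBdryResolventMap Rr V t0' tR' z Hop (Gp z))
    (Gs : ℂ → (SchSp Rr →L[ℂ] EuclideanSpace ℂ (Fin 2)))
    (hGs : ∀ z ∈ resolventSetP Hop,
      IsBdryResolventMap Rr (fun x => (starRingEnd ℂ) (V x))
        ((starRingEnd ℂ) t0') ((starRingEnd ℂ) tR') ((starRingEnd ℂ) z) Hop.adjoint (Gs z)) :
    ∀ z ∈ resolventSetP Hop,
      (∀ i j : Fin 2,
        HasDerivWithinAt
          (fun w =>
            (Λ w *
              Matrix.diagonal ![Complex.sin (t0' - t0), Complex.sin (tR' - tR)]) i j)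
          (⟪EuclideanSpace.single i (1 : ℂ),
            (Gp z) ((ContinuousLinearMap.adjoint (Gs z)) (EuclideanSpace.single j (1 : ℂ)))⟫_ℂ)
          (resolventSetP Hop) z) ∧
      (∀ i j : Fin 2,
        DifferentiableOn ℂ
          (fun w =>
            (Λ w *
              Matrix.diagonal ![Complex.sin (t0' - t0), Complex.sin (tR' - tR)]) i j)
          (resolventSetP Hop)) ∧
      (∀ i j : Fin 2,
        DifferentiableOn ℂ
          (fun w =>
            ⟪EuclideanSpace.single i (1 : ℂ),
              (Gp w) ((ContinuousLinearMap.adjoint (Gs w)) (EuclideanSpace.single j (1 : ℂ)))⟫_ℂ)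
          (resolventSetP Hop)) := by

  have hderiv : ∀ z ∈ resolventSetP Hop, ∀ i j : Fin 2,
      HasDerivWithinAt
        (fun w => (Λ w *
          Matrix.diagonal ![Complex.sin (t0' - t0), Complex.sin (tR' - tR)]) i j)
        (⟪EuclideanSpace.single i (1 : ℂ),
          (Gp z) ((ContinuousLinearMap.adjoint (Gs z)) (EuclideanSpace.single j (1 : ℂ)))⟫_ℂ)
        (resolventSetP Hop) z := by
    intro z hz i j
    obtain ⟨u, du, U, hfam⟩ := hHop.exists_solution_family hR hV (Pi.single j 1)
    obtain ⟨hu, hub, hU⟩ := hfam z hz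
    have hΛu : ∀ w ∈ resolventSetP Hop, Λ w i j = bdryC Rr t0' tR' (u w) (du w) i := by
      intro w hw
      obtain ⟨hv, hvb, -⟩ := hfam w hw
      rw [← hΛ w hw _ _ ⟨hv.hasDeriv, hv.eq_integral⟩, hvb]
      simp
    have hcont : ContinuousWithinAt U (resolventSetP Hop) z :=
      continuousWithinAt_of_res_smul_eq_sub (A := Hop) fun w hw => by
        obtain ⟨hv, hvb, hW⟩ := hfam w hw
        exact hHop.res_smul_eq_sub hR.le hV hz hu hv hU hW (hub.trans hvb.symm)
    rw [hHop.adjoint_bdryResolventMap_single hR.le hV hdense hz (hGs z hz) hu hub hU, map_smul,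
      inner_smul_right, mul_comm]
    simp only [Matrix.mul_diagonal]
    refine HasDerivWithinAt.mul_const ?_ _
    refine hasDerivWithinAt_of_sub_eq
      (g := fun w => ⟪EuclideanSpace.single i (1 : ℂ), Gp z (U w)⟫_ℂ) ?_ fun w hw => ?_
    · exact ((innerSL ℂ (EuclideanSpace.single i (1 : ℂ))).continuous.comp
        (Gp z).continuous).continuousAt.comp_continuousWithinAt hcont
    · obtain ⟨hv, hvb, hW⟩ := hfam w hw
      rw [hΛu w hw, hΛu z hz, EuclideanSpace.inner_single_left, map_one, one_mul]
      exact hHop.bdryC_sub_eq hR.le hV hz hu hv hU hW (hub.trans hvb.symm) (hGp z hz) i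
  have hdiff : ∀ i j : Fin 2, DifferentiableOn ℂ
      (fun w => (Λ w *
        Matrix.diagonal ![Complex.sin (t0' - t0), Complex.sin (tR' - tR)]) i j)
      (resolventSetP Hop) :=
    fun i j w hw => (hderiv w hw i j).differentiableWithinAt
  have hopen := isOpen_resolventSetP Hop
  refine fun z hz => ⟨hderiv z hz, hdiff, fun i j => ((hdiff i j).deriv hopen).congr ?_⟩
  exact fun w hw => ((hderiv w hw i j).hasDerivAt (hopen.mem_nhds hw)).deriv.symm

end
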